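/- Let ν and α satisfy α+ν>-1, let β>-1 and 0<c<b. Then there exist constants C>0 and ω₀>0 such that for every ψ∈W_AC(c,b) and every ω≥ω₀, |∫_c^b (b-x)^β J_ν(ωx) ψ(x) dx| ≤ C ‖ψ‖_{W_AC(c,b)} · ω^{-min{β+3/2, 3/2}}. -/

import Mathlib

open MeasureTheory Set

/-- ψ is absolutely continuous on [a,b] with integrable derivative (FTC characterization). -/
def IsWAC (a b : ℝ) (psi : ℝ → ℝ) : Prop :=
  MeasureTheory.IntegrableOn (deriv psi) (Set.Ioo a b) ∧
  ∀ x ∈ Set.Icc a b, psi x = psi a + ∫ t in a..x, deriv psi t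

/-- The W_AC norm: ‖ψ‖_∞ + ‖ψ'‖_{L¹}. -/
noncomputable def wacNorm (a b : ℝ) (psi : ℝ → ℝ) : ℝ :=
  (⨆ x : Set.Icc a b, |psi (x : ℝ)|) + ∫ t in a..b, |deriv psi t|

/-- Bessel function of the first kind of order ν. -/
noncomputable def besselJ (nu : ℝ) (x : ℝ) : ℝ :=
  ∑' m : ℕ, ((-1 : ℝ) ^ m / ((m.factorial : ℝ) * Real.Gamma ((m : ℝ) + nu + 1))) *
    (x / 2) ^ (2 * (m : ℝ) + nu)


/-- Entire power series: coefficients summable against every radius. -/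
def EntireCoeff (a : ℕ → ℝ) : Prop := ∀ R : ℝ, 0 < R → Summable fun m => |a m| * R ^ m

def shiftCoeff (a : ℕ → ℝ) : ℕ → ℝ := fun m => ((m : ℝ) + 1) * a (m + 1)

noncomputable def pser (a : ℕ → ℝ) (z : ℝ) : ℝ := ∑' m : ℕ, a m * z ^ m

lemma EntireCoeff.shift {a : ℕ → ℝ} (h : EntireCoeff a) : EntireCoeff (shiftCoeff a) := by
  intro R hR
  have h1 := (summable_nat_add_iff 1).2 (h (2 * R) (by positivity))
  have h2 := h1.mul_left (1 / R)
  refine Summable.of_nonneg_of_le (fun m => by positivity) (fun m => ?_) h2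
  have h3 : ((m : ℝ) + 1) ≤ 2 ^ (m + 1) := by
    exact_mod_cast (Nat.lt_two_pow_self (n := m + 1)).le
  have h4 : (1 / R) * (|a (m + 1)| * (2 * R) ^ (m + 1)) = 2 ^ (m + 1) * (|a (m + 1)| * R ^ m) := by
    field_simp
    ring
  rw [h4, shiftCoeff, abs_mul, abs_of_nonneg (by positivity : (0 : ℝ) ≤ (m : ℝ) + 1), mul_assoc]
  gcongr

lemma EntireCoeff.summable {a : ℕ → ℝ} (h : EntireCoeff a) (z : ℝ) :
    Summable fun m => a m * z ^ m := by
  refine Summable.of_norm_bounded (h (|z| + 1) (by positivity)) (fun m => ?_)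
  rw [Real.norm_eq_abs, abs_mul, abs_pow]
  gcongr
  linarith

lemma EntireCoeff.hasDerivAt {a : ℕ → ℝ} (h : EntireCoeff a) (z : ℝ) :
    HasDerivAt (pser a) (pser (shiftCoeff a) z) z := by
  have key : HasDerivAt (fun z => ∑' m : ℕ, a m * z ^ m)
      (∑' m : ℕ, a m * (m * z ^ (m - 1))) z := by
    refine hasDerivAt_tsum_of_isPreconnected (g := fun (m : ℕ) (z : ℝ) => a m * z ^ m)
      (g' := fun (m : ℕ) (z : ℝ) => a m * (m * z ^ (m - 1)))
      (u := fun m => |a m| * (m * (|z| + 1) ^ (m - 1)))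
      (t := Metric.ball (0 : ℝ) (|z| + 1)) (y₀ := (0 : ℝ)) ?_ Metric.isOpen_ball
      (convex_ball _ _).isPreconnected ?_ ?_ ?_ ?_ ?_
    · rw [← summable_nat_add_iff 1]
      refine (h.shift (|z| + 1) (by positivity)).congr (fun m => ?_)
      rw [shiftCoeff, abs_mul, abs_of_nonneg (by positivity : (0 : ℝ) ≤ (m : ℝ) + 1)]
      rw [Nat.add_sub_cancel]
      push_cast
      ring
    · intro n y _
      exact (hasDerivAt_pow n y).const_mul _
    · intro n y hy
      have hy' : |y| < |z| + 1 := by simpa using hy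
      rw [Real.norm_eq_abs, abs_mul, abs_mul, abs_pow, Nat.abs_cast]
      gcongr
    · simp; positivity
    · exact h.summable 0
    · simp
  have e : (∑' m : ℕ, a m * (m * z ^ (m - 1))) = pser (shiftCoeff a) z := by
    rw [tsum_eq_zero_add']
    · simp [pser, shiftCoeff]
      congr 1; ext m; ring
    · refine (h.shift.summable z).congr (fun m => ?_)
      simp [shiftCoeff]; ring
  rw [← e]
  exact key

noncomputable def bcoef (ν : ℝ) (m : ℕ) : ℝ :=
  (-1 : ℝ) ^ m / ((m.factorial : ℝ) * Real.Gamma ((m : ℝ) + ν + 1))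

lemma bcoef_rec (ν : ℝ) (m : ℕ) :
    ((m : ℝ) + 1) * ((m : ℝ) + 1 + ν) * bcoef ν (m + 1) = - bcoef ν m := by
  unfold bcoef
  by_cases h : (m : ℝ) + ν + 1 = 0
  · have : (m : ℝ) + 1 + ν = 0 := by linarith
    simp [h, this, Real.Gamma_zero]
  · have e : ((m + 1 : ℕ) : ℝ) + ν + 1 = ((m : ℝ) + ν + 1) + 1 := by push_cast; ring
    rw [e, Real.Gamma_add_one h, Nat.factorial_succ]
    have h' : (m : ℝ) + 1 + ν ≠ 0 := by intro h2; apply h; linarith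
    have h3 : (m : ℝ) + 1 + ν = (m : ℝ) + ν + 1 := by ring
    rw [h3]
    push_cast
    by_cases hG : Real.Gamma ((m : ℝ) + ν + 1) = 0
    · simp [hG]
    · have : (m : ℝ) + 1 ≠ 0 := by positivity
      have : (m.factorial : ℝ) ≠ 0 := by positivity
      field_simp
      ring

lemma bcoef_entire (ν : ℝ) : EntireCoeff (bcoef ν) := by
  intro R hR
  refine summable_of_ratio_norm_eventually_le (r := 1 / 2) (by norm_num) ?_
  filter_upwards [Filter.eventually_ge_atTop (⌈|ν| + 2 * R⌉₊)] with m hm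
  have hm' : |ν| + 2 * R ≤ m := by
    exact (Nat.le_ceil _).trans (by exact_mod_cast hm)
  have hν := neg_abs_le ν
  have hrec := congrArg abs (bcoef_rec ν m)
  rw [abs_neg, abs_mul, abs_of_nonneg] at hrec
  swap
  · apply mul_nonneg <;> [positivity; linarith]
  rw [Real.norm_eq_abs, Real.norm_eq_abs,
    abs_of_nonneg (show 0 ≤ |bcoef ν (m + 1)| * R ^ (m + 1) by positivity),
    abs_of_nonneg (show 0 ≤ |bcoef ν m| * R ^ m by positivity), ← hrec, pow_succ]
  have h2 : 2 * R ≤ ((m : ℝ) + 1) * ((m : ℝ) + 1 + ν) := by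
    have : 2 * R ≤ (m : ℝ) + 1 + ν := by linarith
    have h0 : (0 : ℝ) ≤ m := by positivity
    nlinarith
  have h3 : 0 ≤ |bcoef ν (m + 1)| * R ^ m := by positivity
  nlinarith [mul_le_mul_of_nonneg_left h2 h3]

lemma pser_ode (ν z : ℝ) :
    z * pser (shiftCoeff (shiftCoeff (bcoef ν))) z + (ν + 1) * pser (shiftCoeff (bcoef ν)) z
      + pser (bcoef ν) z = 0 := by
  have h0 := bcoef_entire ν
  have s0 := h0.summable z
  have s1 := h0.shift.summable z
  have s2 := h0.shift.shift.summable z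
  have e : z * pser (shiftCoeff (shiftCoeff (bcoef ν))) z
      = ∑' m : ℕ, (m : ℝ) * shiftCoeff (bcoef ν) m * z ^ m := by
    rw [tsum_eq_zero_add', pser, ← tsum_mul_left]
    · simp only [CharP.cast_eq_zero, zero_mul, zero_add]
      congr 1; ext m
      simp [shiftCoeff]; ring
    · refine (s2.mul_left z).congr (fun m => ?_)
      simp [shiftCoeff]; ring
  have s3 : Summable fun m : ℕ => (m : ℝ) * shiftCoeff (bcoef ν) m * z ^ m := by
    rw [← summable_nat_add_iff 1]
    refine (s2.mul_left z).congr (fun m => ?_)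
    simp [shiftCoeff]; ring
  rw [e, pser, pser, ← tsum_mul_left, ← s3.tsum_add (s1.mul_left _),
    ← (s3.add (s1.mul_left _)).tsum_add s0]
  convert tsum_zero with m
  have := bcoef_rec ν m
  simp only [shiftCoeff]
  linear_combination z ^ m * this

/-- u(x) = sqrt x * J(x) -/
noncomputable def uF (ν x : ℝ) : ℝ := 2 ^ (-ν) * (x ^ (ν + 1 / 2) * pser (bcoef ν) (x ^ 2 / 4))

noncomputable def vF (ν x : ℝ) : ℝ :=
  2 ^ (-ν) * ((ν + 1 / 2) * x ^ (ν - 1 / 2) * pser (bcoef ν) (x ^ 2 / 4)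
    + x ^ (ν + 1 / 2) * (pser (shiftCoeff (bcoef ν)) (x ^ 2 / 4) * (x / 2)))

lemma besselJ_eq (ν x : ℝ) (hx : 0 < x) : besselJ ν x = x ^ (-(1 / 2) : ℝ) * uF ν x := by
  have h1 : x ^ (-(1 / 2) : ℝ) * uF ν x = (x / 2) ^ ν * pser (bcoef ν) (x ^ 2 / 4) := by
    rw [uF, Real.div_rpow hx.le (by norm_num), Real.rpow_neg (by norm_num : (0 : ℝ) ≤ 2)]
    have : x ^ ν = x ^ (-(1 / 2) : ℝ) * x ^ (ν + 1 / 2) := by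
      rw [← Real.rpow_add hx]; congr 1; ring
    rw [this]; field_simp
  rw [h1, pser, besselJ, ← tsum_mul_left]
  congr 1; ext m
  rw [Real.rpow_add (by positivity), mul_comm 2 (m : ℝ), mul_comm (m : ℝ) 2,
    Real.rpow_mul (by positivity), Real.rpow_natCast, bcoef]
  have : (x / 2) ^ (2 : ℝ) = x ^ 2 / 4 := by
    rw [Real.rpow_two]; ring
  rw [this]; ring

lemma hasDerivAt_pser_sq {a : ℕ → ℝ} (h : EntireCoeff a) (x : ℝ) :
    HasDerivAt (fun x => pser a (x ^ 2 / 4)) (pser (shiftCoeff a) (x ^ 2 / 4) * (x / 2)) x := by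
  have h1 : HasDerivAt (fun x : ℝ => x ^ 2 / 4) (x / 2) x := by
    refine ((hasDerivAt_pow 2 x).div_const 4).congr_deriv ?_
    norm_num; ring
  exact (h.hasDerivAt (x ^ 2 / 4)).comp x h1

lemma uF_deriv (ν x : ℝ) (hx : 0 < x) : HasDerivAt (uF ν) (vF ν x) x := by
  have h1 := hasDerivAt_pser_sq (bcoef_entire ν) x
  have h2 := Real.hasDerivAt_rpow_const (x := x) (p := ν + 1 / 2) (Or.inl hx.ne')
  have := (h2.mul h1).const_mul ((2 : ℝ) ^ (-ν))
  refine this.congr_deriv ?_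
  rw [vF]
  have : ν + 1 / 2 - 1 = ν - 1 / 2 := by ring
  rw [this]

lemma vF_deriv (ν x : ℝ) (hx : 0 < x) :
    HasDerivAt (vF ν) (- uF ν x + (ν ^ 2 - 1 / 4) * uF ν x / x ^ 2) x := by
  have h1 := hasDerivAt_pser_sq (bcoef_entire ν) x
  have h1' := hasDerivAt_pser_sq (bcoef_entire ν).shift x
  have h2 := Real.hasDerivAt_rpow_const (x := x) (p := ν + 1 / 2) (Or.inl hx.ne')
  have h3 := Real.hasDerivAt_rpow_const (x := x) (p := ν - 1 / 2) (Or.inl hx.ne')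
  have h4 : HasDerivAt (fun x : ℝ => x / 2) (1 / 2) x := (hasDerivAt_id x).div_const 2
  have := (((h3.const_mul (ν + 1 / 2)).mul h1).add (h2.mul (h1'.mul h4))).const_mul ((2 : ℝ) ^ (-ν))
  refine this.congr_deriv ?_
  rw [uF]
  have ode := pser_ode ν (x ^ 2 / 4)
  have e1 : x ^ (ν + 1 / 2) = x ^ (ν - 1 / 2 - 1) * x ^ 2 := by
    rw [← Real.rpow_natCast, ← Real.rpow_add hx]; congr 1; push_cast; ring
  have e2 : x ^ (ν - 1 / 2) = x ^ (ν - 1 / 2 - 1) * x := by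
    nth_rewrite 3 [← Real.rpow_one x]
    rw [← Real.rpow_add hx]; congr 1; ring
  have e3 : ν + 1 / 2 - 1 = ν - 1 / 2 := by ring
  rw [e3, e1, e2]
  have hx' := hx.ne'
  simp only [Pi.mul_apply]
  field_simp
  linear_combination 16 * x ^ 2 * ode

lemma energy_bound (ν : ℝ) : ∃ M : ℝ, 0 < M ∧ ∀ x, 1 ≤ x → |uF ν x| ≤ M ∧ |vF ν x| ≤ M := by
  set L := |ν ^ 2 - 1 / 4| with hL
  set E : ℝ → ℝ := fun x => (uF ν x ^ 2 + vF ν x ^ 2) * Real.exp (L / x) with hE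
  have hd : ∀ x, 0 < x → HasDerivAt E
      ((2 * (ν ^ 2 - 1 / 4) * uF ν x * vF ν x / x ^ 2
        - L / x ^ 2 * (uF ν x ^ 2 + vF ν x ^ 2)) * Real.exp (L / x)) x := by
    intro x hx
    have h1 := (((uF_deriv ν x hx).pow 2).add ((vF_deriv ν x hx).pow 2))
    have h2 : HasDerivAt (fun x : ℝ => L / x) (- L / x ^ 2) x := by
      have := (hasDerivAt_inv hx.ne').const_mul L
      refine this.congr_deriv ?_
      field_simp
    refine (h1.mul h2.exp).congr_deriv ?_
    simp
    field_simp
    ring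
  have hanti : AntitoneOn E (Ici 1) := by
    refine antitoneOn_of_deriv_nonpos (convex_Ici 1) ?_ ?_ ?_
    · intro x hx
      exact (hd x (lt_of_lt_of_le one_pos hx)).continuousAt.continuousWithinAt
    · intro x hx
      rw [interior_Ici] at hx
      exact (hd x (lt_trans one_pos hx)).differentiableAt.differentiableWithinAt
    · intro x hx
      rw [interior_Ici] at hx
      have hx0 : 0 < x := lt_trans one_pos hx
      rw [(hd x hx0).deriv]
      apply mul_nonpos_of_nonpos_of_nonneg _ (Real.exp_pos _).le
      have h1 : 2 * (ν ^ 2 - 1 / 4) * uF ν x * vF ν x ≤ L * (uF ν x ^ 2 + vF ν x ^ 2) := by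
        have a1 : (ν ^ 2 - 1 / 4) * (2 * uF ν x * vF ν x) ≤ L * |2 * uF ν x * vF ν x| := by
          rw [hL, ← abs_mul]; exact le_abs_self _
        have a2 : |2 * uF ν x * vF ν x| ≤ uF ν x ^ 2 + vF ν x ^ 2 := by
          rw [abs_le]; constructor <;> nlinarith [sq_nonneg (uF ν x + vF ν x), sq_nonneg (uF ν x - vF ν x)]
        have a3 := mul_le_mul_of_nonneg_left a2 (abs_nonneg (ν ^ 2 - 1 / 4))
        rw [← hL] at a3
        linarith
      have : 2 * (ν ^ 2 - 1 / 4) * uF ν x * vF ν x / x ^ 2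
        - L / x ^ 2 * (uF ν x ^ 2 + vF ν x ^ 2) =
        (2 * (ν ^ 2 - 1 / 4) * uF ν x * vF ν x - L * (uF ν x ^ 2 + vF ν x ^ 2)) / x ^ 2 := by ring
      rw [this]
      exact div_nonpos_of_nonpos_of_nonneg (by linarith) (by positivity)
  have hE1 : 0 ≤ E 1 := by positivity
  refine ⟨Real.sqrt (E 1) + 1, by positivity, fun x hx => ?_⟩
  have hxE : E x ≤ E 1 := hanti (by simp) hx hx
  have hx0 : 0 < x := lt_of_lt_of_le one_pos hx
  have hle : uF ν x ^ 2 + vF ν x ^ 2 ≤ E 1 := by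
    refine le_trans ?_ hxE
    apply le_mul_of_one_le_right (by positivity)
    apply Real.one_le_exp; positivity
  constructor
  · have := Real.abs_le_sqrt (show uF ν x ^ 2 ≤ E 1 by nlinarith [sq_nonneg (vF ν x)])
    linarith
  · have := Real.abs_le_sqrt (show vF ν x ^ 2 ≤ E 1 by nlinarith [sq_nonneg (uF ν x)])
    linarith

lemma ibp_bound {f g g' : ℝ → ℝ} {p q A : ℝ} (hpq : p ≤ q)
    (hf : IntervalIntegrable f volume p q) (hg' : IntervalIntegrable g' volume p q)
    (hg : ∀ x ∈ Icc p q, g x = g p + ∫ t in p..x, g' t)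
    (hA : ∀ x ∈ Icc p q, |∫ t in p..x, f t| ≤ A) :
    |∫ x in p..q, f x * g x| ≤ A * (|g q| + ∫ x in p..q, |g' x|) := by
  set F : ℝ → ℝ := fun x => ∫ t in p..x, f t with hF
  set G : ℝ → ℝ := fun x => ∫ t in p..x, g' t with hG
  have hp : p ∈ uIcc p q := left_mem_uIcc
  have acF : AbsolutelyContinuousOnInterval F p q :=
    hf.absolutelyContinuousOnInterval_intervalIntegral hp
  have acG : AbsolutelyContinuousOnInterval G p q :=
    hg'.absolutelyContinuousOnInterval_intervalIntegral hp
  have key := acF.integral_mul_deriv_eq_deriv_mul acG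
  have e1 : ∫ x in p..q, F x * deriv G x = ∫ x in p..q, F x * g' x := by
    apply intervalIntegral.integral_congr_ae
    filter_upwards [hg'.ae_hasDerivAt_integral] with x hx hx2
    rw [(hx (uIoc_subset_uIcc hx2) p hp).deriv]
  have e2 : ∫ x in p..q, deriv F x * G x = ∫ x in p..q, f x * G x := by
    apply intervalIntegral.integral_congr_ae
    filter_upwards [hf.ae_hasDerivAt_integral] with x hx hx2
    rw [(hx (uIoc_subset_uIcc hx2) p hp).deriv]
  have e3 : ∫ x in p..q, f x * g x = g p * F q + ∫ x in p..q, f x * G x := by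
    have : ∫ x in p..q, f x * g x = ∫ x in p..q, (g p * f x + f x * G x) := by
      apply intervalIntegral.integral_congr
      intro x hx
      rw [uIcc_of_le hpq] at hx
      simp only [hG]
      rw [hg x hx]; ring
    rw [this, intervalIntegral.integral_add (hf.const_mul _)
      (hf.mul_continuousOn acG.continuousOn), intervalIntegral.integral_const_mul]
  have hFp : F p = 0 := by simp [hF]
  have e4 : ∫ x in p..q, f x * g x = F q * g q - ∫ x in p..q, F x * g' x := by
    rw [e1, e2, hFp] at key
    rw [e3, hg q (right_mem_Icc.2 hpq)]
    have : G q = ∫ t in p..q, g' t := rfl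
    rw [← this]
    linarith
  have hFq : |F q| ≤ A := hA q (right_mem_Icc.2 hpq)
  have b1 : |∫ x in p..q, F x * g' x| ≤ A * ∫ x in p..q, |g' x| := by
    rw [← intervalIntegral.integral_const_mul]
    refine (intervalIntegral.abs_integral_le_integral_abs hpq).trans ?_
    refine intervalIntegral.integral_mono_on hpq
      (hg'.continuousOn_mul acF.continuousOn).abs (hg'.abs.const_mul _) ?_
    intro x hx
    rw [abs_mul]
    exact mul_le_mul_of_nonneg_right (hA x hx) (abs_nonneg _)
  rw [e4, mul_add]
  refine (abs_sub _ _).trans (add_le_add ?_ b1)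
  rw [abs_mul]
  exact mul_le_mul_of_nonneg_right hFq (abs_nonneg _)

lemma mono_bound {f g g' : ℝ → ℝ} {p q A : ℝ} (hpq : p ≤ q)
    (hf : IntervalIntegrable f volume p q)
    (hgc : ContinuousOn g (Icc p q)) (hgd : ∀ x ∈ Ioo p q, HasDerivAt g (g' x) x)
    (hpos : ∀ x ∈ Ioo p q, 0 ≤ g' x)
    (hA : ∀ x ∈ Icc p q, |∫ t in p..x, f t| ≤ A) :
    |∫ x in p..q, f x * g x| ≤ A * (|g q| + |g q - g p|) := by
  have hfi : IntervalIntegrable g' volume p q := by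
    apply intervalIntegral.intervalIntegrable_deriv_of_nonneg (g := g)
    · rwa [uIcc_of_le hpq]
    · simpa [hpq] using hgd
    · simpa [hpq] using hpos
  have ftc : ∀ x ∈ Icc p q, ∫ t in p..x, g' t = g x - g p := by
    intro x hx
    apply intervalIntegral.integral_eq_sub_of_hasDerivAt_of_le hx.1
      (hgc.mono (Icc_subset_Icc_right hx.2))
      (fun y hy => hgd y ⟨hy.1, hy.2.trans_le hx.2⟩)
    apply hfi.mono_set
    rw [uIcc_of_le hpq, uIcc_of_le hx.1]
    exact Icc_subset_Icc_right hx.2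
  have h1 := ibp_bound (g := g) hpq hf hfi (fun x hx => by rw [ftc x hx]; ring) hA
  have h2 : ∫ x in p..q, |g' x| = g q - g p := by
    rw [← ftc q (right_mem_Icc.2 hpq)]
    apply intervalIntegral.integral_congr_ae
    have : ∀ᵐ x : ℝ, x ≠ q := by simp [ae_iff, measure_singleton]
    filter_upwards [this] with x hx hx2
    rw [uIoc_of_le hpq] at hx2
    exact abs_of_nonneg (hpos x ⟨hx2.1, lt_of_le_of_ne hx2.2 hx⟩)
  rw [h2] at h1
  have hA0 : 0 ≤ A := (abs_nonneg _).trans (hA q (right_mem_Icc.2 hpq))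
  refine h1.trans ?_
  gcongr
  exact le_abs_self _

lemma besselJ_cont (ν : ℝ) : ContinuousOn (besselJ ν) (Ioi 0) := by
  have : ContinuousOn (fun x => x ^ (-(1 / 2) : ℝ) * uF ν x) (Ioi 0) := by
    intro x hx
    exact ((Real.continuousAt_rpow_const x _ (Or.inl (ne_of_gt hx))).mul
      (uF_deriv ν x hx).continuousAt).continuousWithinAt
  exact this.congr (fun x hx => besselJ_eq ν x hx)

lemma besselJ_bounds (ν : ℝ) : ∃ K : ℝ, 0 < K ∧ (∀ x, 1 ≤ x → |besselJ ν x| ≤ K * x ^ (-(1 / 2) : ℝ)) ∧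
    ∀ p q, 1 ≤ p → p ≤ q → |∫ y in p..q, besselJ ν y| ≤ K * p ^ (-(1 / 2) : ℝ) := by
  obtain ⟨M, hM, hb⟩ := energy_bound ν
  set L := |ν ^ 2 - 1 / 4| with hL
  have hL0 : 0 ≤ L := abs_nonneg _
  refine ⟨M * (3 + 2 * L), by positivity, ?_, ?_⟩
  · intro x hx
    have hx0 : 0 < x := by linarith
    rw [besselJ_eq ν x hx0, abs_mul, abs_of_pos (by positivity : 0 < x ^ (-(1 / 2) : ℝ)), mul_comm]
    gcongr
    refine (hb x hx).1.trans ?_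
    nlinarith
  intro p q hp hpq
  have hp0 : 0 < p := by linarith
  set R : ℝ → ℝ := fun y => (1 / 2) * y ^ (-(3 / 2) : ℝ) * vF ν y
    - (ν ^ 2 - 1 / 4) * y ^ (-(1 / 2) : ℝ) * uF ν y / y ^ 2 with hR
  have hd : ∀ y ∈ uIcc p q, HasDerivAt (fun y => - (y ^ (-(1 / 2) : ℝ) * vF ν y))
      (besselJ ν y + R y) y := by
    intro y hy
    rw [uIcc_of_le hpq] at hy
    have hy0 : 0 < y := hp0.trans_le hy.1
    have h1 := Real.hasDerivAt_rpow_const (x := y) (p := -(1 / 2)) (Or.inl hy0.ne')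
    refine ((h1.mul (vF_deriv ν y hy0)).neg).congr_deriv ?_
    rw [besselJ_eq ν y hy0]
    have : (-(1 / 2) - 1 : ℝ) = -(3 / 2) := by norm_num
    rw [this]
    simp only [hR]
    ring
  have sub : uIcc p q ⊆ Ioi 0 := by
    rw [uIcc_of_le hpq]; intro y hy; exact hp0.trans_le hy.1
  have iJ : IntervalIntegrable (besselJ ν) volume p q :=
    ((besselJ_cont ν).mono sub).intervalIntegrable
  have cR : ContinuousOn R (uIcc p q) := by
    intro y hy
    have hy0 : 0 < y := sub hy
    have c1 := Real.continuousAt_rpow_const y (-(3 / 2)) (Or.inl hy0.ne')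
    have c2 := Real.continuousAt_rpow_const y (-(1 / 2)) (Or.inl hy0.ne')
    have c3 := (uF_deriv ν y hy0).continuousAt
    have c4 := (vF_deriv ν y hy0).continuousAt
    have c5 : ContinuousAt (fun y : ℝ => y ^ 2) y := by fun_prop
    exact (((continuousAt_const.mul c1).mul c4).sub
      (((continuousAt_const.mul c2).mul c3).div c5 (by positivity))).continuousWithinAt
  have iR : IntervalIntegrable R volume p q := cR.intervalIntegrable
  have ftc := intervalIntegral.integral_eq_sub_of_hasDerivAt hd (iJ.add iR)
  rw [intervalIntegral.integral_add iJ iR] at ftc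
  have hz : (0 : ℝ) ∉ uIcc p q := fun h => lt_irrefl (0 : ℝ) (sub h)
  have ipow : IntervalIntegrable (fun y : ℝ => y ^ (-(3 / 2) : ℝ)) volume p q :=
    intervalIntegral.intervalIntegrable_rpow (Or.inr hz)
  have bR : |∫ y in p..q, R y| ≤ M * (1 / 2 + L) * (2 * p ^ (-(1 / 2) : ℝ)) := by
    have : ∫ y in p..q, M * (1 / 2 + L) * y ^ (-(3 / 2) : ℝ) ≤
        M * (1 / 2 + L) * (2 * p ^ (-(1 / 2) : ℝ)) := by
      rw [intervalIntegral.integral_const_mul, integral_rpow (Or.inr ⟨by norm_num, hz⟩)]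
      gcongr
      have e : (-(3 / 2) + 1 : ℝ) = -(1 / 2) := by norm_num
      rw [e]
      have : 0 < q ^ (-(1 / 2) : ℝ) := Real.rpow_pos_of_pos (by linarith) _
      linarith
    refine le_trans ?_ this
    refine (intervalIntegral.abs_integral_le_integral_abs hpq).trans ?_
    refine intervalIntegral.integral_mono_on hpq iR.abs (ipow.const_mul _) ?_
    intro y hy
    have hy1 : 1 ≤ y := hp.trans hy.1
    have hy0 : 0 < y := by linarith
    have hpw : 0 < y ^ (-(3 / 2) : ℝ) := Real.rpow_pos_of_pos hy0 _
    have e : y ^ (-(1 / 2) : ℝ) / y ^ 2 ≤ y ^ (-(3 / 2) : ℝ) := by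
      rw [← Real.rpow_natCast, ← Real.rpow_sub hy0]
      apply Real.rpow_le_rpow_of_exponent_le hy1
      norm_num
    have e0 : 0 ≤ y ^ (-(1 / 2) : ℝ) / y ^ 2 := by positivity
    have eR : R y = (1 / 2) * y ^ (-(3 / 2) : ℝ) * vF ν y
      - (ν ^ 2 - 1 / 4) * (y ^ (-(1 / 2) : ℝ) / y ^ 2) * uF ν y := by simp only [hR]; ring
    rw [eR]
    obtain ⟨hu, hv⟩ := hb y hy1
    have t1 : |(1 / 2) * y ^ (-(3 / 2) : ℝ) * vF ν y| ≤ (1 / 2) * y ^ (-(3 / 2) : ℝ) * M := by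
      rw [abs_mul, abs_of_nonneg (show 0 ≤ (1 / 2) * y ^ (-(3 / 2) : ℝ) by positivity)]
      gcongr
    have t2 : |(ν ^ 2 - 1 / 4) * (y ^ (-(1 / 2) : ℝ) / y ^ 2) * uF ν y|
        ≤ L * y ^ (-(3 / 2) : ℝ) * M := by
      rw [abs_mul, abs_mul, ← hL, abs_of_nonneg e0]
      gcongr
    have t3 := abs_sub ((1 / 2) * y ^ (-(3 / 2) : ℝ) * vF ν y)
      ((ν ^ 2 - 1 / 4) * (y ^ (-(1 / 2) : ℝ) / y ^ 2) * uF ν y)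
    nlinarith
  have bb : ∀ y, p ≤ y → |y ^ (-(1 / 2) : ℝ) * vF ν y| ≤ p ^ (-(1 / 2) : ℝ) * M := by
    intro y hy
    have hy0 : 0 < y := hp0.trans_le hy
    rw [abs_mul, abs_of_pos (Real.rpow_pos_of_pos hy0 _)]
    gcongr ?_ * ?_
    · exact Real.rpow_le_rpow_of_nonpos hp0 hy (by norm_num)
    · exact (hb y (hp.trans hy)).2
  have b1 := abs_le.1 (bb p le_rfl)
  have b2 := abs_le.1 (bb q hpq)
  have b3 := abs_le.1 bR
  rw [abs_le]
  constructor <;> nlinarith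

/-- Bound for the weighted primitive of the Bessel function. -/
lemma primitive_bound (ν β b c : ℝ) (hβ : -1 < β) (hc : 0 < c) (hcb : c < b) :
    ∃ C : ℝ, 0 < C ∧ ∃ ω₀ : ℝ, 0 < ω₀ ∧ ∀ ω : ℝ, ω₀ ≤ ω →
      IntervalIntegrable (fun x => (b - x) ^ β * besselJ ν (ω * x)) volume c b ∧
      ∀ x ∈ Icc c b, |∫ t in c..x, (b - t) ^ β * besselJ ν (ω * t)| ≤
        C * ω ^ (-(min (β + 3 / 2) (3 / 2))) := by
  obtain ⟨K, hK, hJ, hI⟩ := besselJ_bounds ν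
  set K' := K * c ^ (-(1 / 2) : ℝ) with hK'
  have hK'0 : 0 < K' := by positivity
  have hbc : 0 < b - c := by linarith
  set D := (b - c) ^ β with hD
  have hD0 : 0 < D := by positivity
  have hβ1 : 0 < β + 1 := by linarith
  refine ⟨K' * (2 * D + 2 + 1 / (β + 1)), by positivity, max 1 (max (1 / c) (1 / (b - c))),
    by positivity, ?_⟩
  intro ω hω
  have hω1 : 1 ≤ ω := (le_max_left _ _).trans hω
  have hωc : 1 ≤ ω * c := by
    have : 1 / c ≤ ω := ((le_max_left _ _).trans (le_max_right _ _)).trans hω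
    rwa [div_le_iff₀ hc] at this
  have hωb : 1 ≤ ω * (b - c) := by
    have : 1 / (b - c) ≤ ω := ((le_max_right _ _).trans (le_max_right _ _)).trans hω
    rwa [div_le_iff₀ hbc] at this
  have hω0 : 0 < ω := by linarith
  have cJ : ContinuousOn (fun x => besselJ ν (ω * x)) (Icc c b) := by
    refine (besselJ_cont ν).comp (by fun_prop) (fun x hx => ?_)
    exact mul_pos hω0 (hc.trans_le hx.1)
  have iW : ∀ p q : ℝ, IntervalIntegrable (fun x => (b - x) ^ β) volume p q := by
    intro p q
    have := (intervalIntegral.intervalIntegrable_rpow' (a := b - p) (b := b - q) hβ).comp_sub_left b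
    simpa using this
  have iH : ∀ p q, p ∈ Icc c b → q ∈ Icc c b →
      IntervalIntegrable (fun x => (b - x) ^ β * besselJ ν (ω * x)) volume p q := by
    intro p q hp hq
    exact (iW p q).mul_continuousOn (cJ.mono (uIcc_subset_Icc hp hq))
  have iJ : ∀ p q, p ∈ Icc c b → q ∈ Icc c b →
      IntervalIntegrable (fun x => besselJ ν (ω * x)) volume p q := by
    intro p q hp hq
    exact (cJ.mono (uIcc_subset_Icc hp hq)).intervalIntegrable
  have hcm : c ∈ Icc c b := left_mem_Icc.2 hcb.le
  refine ⟨iH c b hcm (right_mem_Icc.2 hcb.le), ?_⟩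
  -- primitive of the unweighted function
  have hA : ∀ x ∈ Icc c b, |∫ t in c..x, besselJ ν (ω * t)| ≤ K' * ω ^ (-(3 / 2) : ℝ) := by
    intro x hx
    rw [intervalIntegral.integral_comp_mul_left _ hω0.ne', smul_eq_mul, abs_mul,
      abs_of_pos (inv_pos.2 hω0)]
    have h1 := hI (ω * c) (ω * x) hωc (by gcongr; exact hx.1)
    have e : K' * ω ^ (-(3 / 2) : ℝ) = ω⁻¹ * (K * (ω * c) ^ (-(1 / 2) : ℝ)) := by
      rw [Real.mul_rpow hω0.le hc.le, ← Real.rpow_neg_one, hK']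
      have : ω ^ (-(3 / 2) : ℝ) = ω ^ (-1 : ℝ) * ω ^ (-(1 / 2) : ℝ) := by
        rw [← Real.rpow_add hω0]; norm_num
      rw [this]; ring
    rw [e]
    gcongr
  have hpt : ∀ x ∈ Icc c b, |besselJ ν (ω * x)| ≤ K' * ω ^ (-(1 / 2) : ℝ) := by
    intro x hx
    have h1 : ω * c ≤ ω * x := by gcongr; exact hx.1
    refine (hJ _ (hωc.trans h1)).trans ?_
    rw [hK', mul_assoc, mul_comm (c ^ _), ← Real.mul_rpow hω0.le hc.le]
    exact mul_le_mul_of_nonneg_left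
      (Real.rpow_le_rpow_of_nonpos (by positivity) h1 (by norm_num)) hK.le
  have hgd : ∀ x, x < b → HasDerivAt (fun x => (b - x) ^ β) (-(β * (b - x) ^ (β - 1))) x := by
    intro x hx
    have h1 : HasDerivAt (fun x => b - x) (-1) x := by
      simpa using (hasDerivAt_id x).const_sub b
    refine (h1.rpow_const (p := β) (Or.inl (by linarith))).congr_deriv ?_
    ring
  have hω32 : 0 < ω ^ (-(3 / 2) : ℝ) := by positivity
  rcases le_or_gt 0 β with hβ0 | hβ0
  · -- nonnegative exponent
    intro x hx
    have hmin : min (β + 3 / 2) (3 / 2) = 3 / 2 := min_eq_right (by linarith)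
    rw [hmin]
    have h1 := mono_bound (g := fun x => -(b - x) ^ β) (g' := fun x => β * (b - x) ^ (β - 1))
      hx.1 (iJ c x hcm hx)
      (ContinuousOn.neg (ContinuousOn.rpow_const (by fun_prop) (fun _ _ => Or.inr hβ0)))
      (fun y hy => by
        exact (hgd y (hy.2.trans_le hx.2)).neg.congr_deriv (neg_neg _))
      (fun y hy => by
        have : 0 < b - y := by linarith [hy.2.trans_le hx.2]
        positivity)
      (fun y hy => hA y ⟨hy.1, hy.2.trans hx.2⟩)
    have e : ∫ t in c..x, (b - t) ^ β * besselJ ν (ω * t) =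
        - ∫ t in c..x, besselJ ν (ω * t) * -(b - t) ^ β := by
      rw [← intervalIntegral.integral_neg]; congr 1; ext t; ring
    rw [e, abs_neg]
    refine h1.trans ?_
    have hbx : 0 ≤ b - x := by linarith [hx.2]
    have d1 : (b - x) ^ β ≤ D := Real.rpow_le_rpow hbx (by linarith [hx.1]) hβ0
    have d0 : 0 ≤ (b - x) ^ β := by positivity
    have d2 : |-(b - x) ^ β| + |-(b - x) ^ β - -(b - c) ^ β| ≤ 2 * D + 2 + 1 / (β + 1) := by
      rw [abs_neg, abs_of_nonneg d0, abs_of_nonneg (by rw [← hD]; linarith), ← hD]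
      have : 0 < 1 / (β + 1) := by positivity
      linarith
    calc _ ≤ K' * ω ^ (-(3 / 2) : ℝ) * (2 * D + 2 + 1 / (β + 1)) := by gcongr
      _ = _ := by ring
  · -- negative exponent
    have hmin : min (β + 3 / 2) (3 / 2) = β + 3 / 2 := min_eq_left (by linarith)
    rw [hmin]
    have hPpos : 0 < ω ^ (-(β + 3 / 2)) := by positivity
    set m := b - ω⁻¹ with hm
    have hinv : 0 < ω⁻¹ := by positivity
    have hcm' : c ≤ m := by
      have : ω⁻¹ ≤ b - c := by rw [inv_le_iff_one_le_mul₀ hω0, mul_comm]; exact hωb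
      linarith
    have hmm : m ∈ Icc c b := ⟨hcm', by linarith⟩
    have first : ∀ x ∈ Icc c m, |∫ t in c..x, (b - t) ^ β * besselJ ν (ω * t)| ≤
        2 * K' * ω ^ (-(β + 3 / 2)) := by
      intro x hx
      have hxb : x < b := by linarith [hx.2]
      have hxm : x ∈ Icc c b := ⟨hx.1, hxb.le⟩
      have h1 := mono_bound (g := fun x => (b - x) ^ β) (g' := fun x => -(β * (b - x) ^ (β - 1)))
        hx.1 (iJ c x hcm hxm)
        (fun y hy => (hgd y (by linarith [hy.2])).continuousAt.continuousWithinAt)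
        (fun y hy => hgd y (by linarith [hy.2]))
        (fun y hy => by
          have : 0 < b - y := by linarith [hy.2]
          have : 0 < (b - y) ^ (β - 1) := by positivity
          nlinarith)
        (fun y hy => hA y ⟨hy.1, hy.2.trans hxb.le⟩)
      have e : ∫ t in c..x, (b - t) ^ β * besselJ ν (ω * t) =
          ∫ t in c..x, besselJ ν (ω * t) * (b - t) ^ β := by
        congr 1; ext t; ring
      rw [e]
      refine h1.trans ?_
      have hbx : 0 < b - x := by linarith
      have d1 : (b - x) ^ β ≤ ω ^ (-β) := by
        rw [Real.rpow_neg hω0.le, ← Real.inv_rpow hω0.le]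
        exact Real.rpow_le_rpow_of_nonpos hinv (by linarith [hx.2]) hβ0.le
      have d0 : 0 < (b - x) ^ β := by positivity
      have d3 : D ≤ (b - x) ^ β := Real.rpow_le_rpow_of_nonpos hbx (by linarith [hx.1]) hβ0.le
      have d2 : |(b - x) ^ β| + |(b - x) ^ β - (b - c) ^ β| ≤ 2 * ω ^ (-β) := by
        rw [abs_of_nonneg d0.le, abs_of_nonneg (by rw [← hD]; linarith), ← hD]
        linarith
      have e2 : ω ^ (-(β + 3 / 2)) = ω ^ (-(3 / 2) : ℝ) * ω ^ (-β) := by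
        rw [← Real.rpow_add hω0]; congr 1; ring
      calc _ ≤ K' * ω ^ (-(3 / 2) : ℝ) * (2 * ω ^ (-β)) := by gcongr
        _ = _ := by rw [e2]; ring
    intro x hx
    have hquot : 0 < 1 / (β + 1) := by positivity
    rcases le_total x m with hxm | hxm
    · refine (first x ⟨hx.1, hxm⟩).trans ?_
      have : 2 * K' ≤ K' * (2 * D + 2 + 1 / (β + 1)) := by nlinarith
      gcongr
    · have second : |∫ t in m..x, (b - t) ^ β * besselJ ν (ω * t)| ≤
          K' * (1 / (β + 1)) * ω ^ (-(β + 3 / 2)) := by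
        have s1 : |∫ t in m..x, (b - t) ^ β * besselJ ν (ω * t)| ≤
            ∫ t in m..x, K' * ω ^ (-(1 / 2) : ℝ) * (b - t) ^ β := by
          refine (intervalIntegral.abs_integral_le_integral_abs hxm).trans ?_
          refine intervalIntegral.integral_mono_on hxm (iH m x hmm hx).abs
            ((iW m x).const_mul _) ?_
          intro t ht
          have hbt : 0 ≤ b - t := by linarith [ht.2, hx.2]
          rw [abs_mul, abs_of_nonneg (by positivity), mul_comm]
          gcongr
          exact hpt t ⟨hcm'.trans ht.1, ht.2.trans hx.2⟩
        refine s1.trans ?_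
        rw [intervalIntegral.integral_const_mul,
          intervalIntegral.integral_comp_sub_left (fun t => t ^ β) b,
          integral_rpow (Or.inl hβ)]
        have e1 : b - m = ω⁻¹ := by rw [hm]; ring
        have e2 : ω ^ (-(β + 3 / 2)) = ω ^ (-(1 / 2) : ℝ) * (ω⁻¹) ^ (β + 1) := by
          rw [Real.inv_rpow hω0.le, ← Real.rpow_neg hω0.le, ← Real.rpow_add hω0]; congr 1; ring
        rw [e1, e2]
        have hbx : 0 ≤ b - x := by linarith [hx.2]
        have d0 : 0 ≤ (b - x) ^ (β + 1) := by positivity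
        calc _ ≤ K' * ω ^ (-(1 / 2) : ℝ) * ((ω⁻¹) ^ (β + 1) / (β + 1)) := by
              gcongr; linarith
          _ = _ := by ring
      rw [← intervalIntegral.integral_add_adjacent_intervals (iH c m hcm hmm) (iH m x hmm hx)]
      have f := first m ⟨hcm', le_rfl⟩
      refine (abs_add_le _ _).trans ((add_le_add f second).trans ?_)
      have : 0 ≤ K' * (2 * D) * ω ^ (-(β + 3 / 2)) := by positivity
      nlinarith

theorem van_der_corput_bessel_away (ν α β b c : ℝ) (hαν : -1 < α + ν) (hβ : -1 < β)
    (hc : 0 < c) (hcb : c < b) :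
    ∃ C : ℝ, 0 < C ∧ ∃ ω₀ : ℝ, 0 < ω₀ ∧
      ∀ ψ : ℝ → ℝ, IsWAC c b ψ → ∀ ω : ℝ, ω₀ ≤ ω →
        |∫ x in c..b, (b - x) ^ β * besselJ ν (ω * x) * ψ x| ≤
          C * wacNorm c b ψ * ω ^ (-(min (β + 3 / 2) (3 / 2))) := by
  obtain ⟨C, hC, ω₀, hω₀, H⟩ := primitive_bound ν β b c hβ hc hcb
  refine ⟨C, hC, ω₀, hω₀, ?_⟩
  intro ψ hψ ω hω
  obtain ⟨hfi, hA⟩ := H ω hω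
  have hω0 : 0 < ω := hω₀.trans_le hω
  have iψ : IntervalIntegrable (deriv ψ) volume c b :=
    (intervalIntegrable_iff_integrableOn_Ioo_of_le hcb.le).2 hψ.1
  have h1 := ibp_bound hcb.le hfi iψ hψ.2 hA
  refine h1.trans ?_
  have hbdd : BddAbove (range fun x : Icc c b => |ψ (x : ℝ)|) := by
    refine ⟨|ψ c| + ∫ t in c..b, |deriv ψ t|, ?_⟩
    rintro _ ⟨⟨x, hx⟩, rfl⟩
    simp only
    rw [hψ.2 x hx]
    refine (abs_add_le _ _).trans (add_le_add le_rfl ?_)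
    refine (intervalIntegral.abs_integral_le_integral_abs hx.1).trans ?_
    exact intervalIntegral.integral_mono_interval le_rfl hx.1 hx.2
      (Filter.Eventually.of_forall (fun _ => abs_nonneg _)) iψ.abs
  have hsup : |ψ b| ≤ ⨆ x : Icc c b, |ψ (x : ℝ)| :=
    le_ciSup hbdd ⟨b, right_mem_Icc.2 hcb.le⟩
  calc _ ≤ C * ω ^ (-(min (β + 3 / 2) (3 / 2))) * wacNorm c b ψ := by
        unfold wacNorm
        gcongr
    _ = _ := by ring
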